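/- arXiv:2605.05129 — 7 statements merged into one kernel-verified Lean document; each statement's English description precedes it below -/
import Mathlib

section
/- Let H be a real inner product space and let a, b, c ∈ H. Then ⟨(3/2)a − 2b + (1/2)c, a⟩ = (1/4)‖a − 2b + c‖² + [ (5/4)‖a‖² − ⟨a,b⟩ + (1/4)‖b‖² ] − [ (5/4)‖b‖² − ⟨b,c⟩ + (1/4)‖c‖² ]. -/
open scoped RealInnerProductSpace

/-- G-stability (Dahlquist) identity for the BDF2 backward difference. -/
theorem bdf2_g_stability_identity {H : Type*} [NormedAddCommGroup H]
    [InnerProductSpace ℝ H] (a b c : H) :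
    ⟪(3 / 2 : ℝ) • a - (2 : ℝ) • b + (1 / 2 : ℝ) • c, a⟫ =
      (1 / 4 : ℝ) * ‖a - (2 : ℝ) • b + c‖ ^ 2
        + ((5 / 4 : ℝ) * ‖a‖ ^ 2 - ⟪a, b⟫ + (1 / 4 : ℝ) * ‖b‖ ^ 2)
        - ((5 / 4 : ℝ) * ‖b‖ ^ 2 - ⟪b, c⟫ + (1 / 4 : ℝ) * ‖c‖ ^ 2) := by
  simp only [← real_inner_self_eq_norm_sq, inner_add_left, inner_add_right, inner_sub_left,
    inner_sub_right, real_inner_smul_left, real_inner_smul_right]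
  rw [real_inner_comm a b, real_inner_comm a c, real_inner_comm b c]
  ring
end

section
/- Let V be a real vector space, let e : ℕ → V with e(0) = 0 and e(1) = 0, and let f : ℕ → V be such that (3/2)·e(n) − 2·e(n−1) + (1/2)·e(n−2) = f(n) for every n ≥ 2. Then for every n ∈ ℕ one has e(n) = Σ_{j=2}^{n} (1 − (1/3)^{n−j+1}) · f(j), where the sum over an empty range is zero. -/
/-- The discrete convolution of `f` with powers of `r` obeys a one-step recurrence. -/
theorem sum_Icc_two_pow_smul_succ {R V : Type*} [CommSemiring R] [AddCommMonoid V] [Module R V]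
    (r : R) (f : ℕ → V) (n : ℕ) (hn : 1 ≤ n) :
    ∑ j ∈ Finset.Icc 2 (n + 1), r ^ (n + 1 - j + 1) • f j =
      r • (∑ j ∈ Finset.Icc 2 n, r ^ (n - j + 1) • f j + f (n + 1)) := by
  rw [Finset.sum_Icc_succ_top (by omega), smul_add, Finset.smul_sum]
  congr 1
  · refine Finset.sum_congr rfl fun j hj => ?_
    have hj' := (Finset.mem_Icc.mp hj).2
    rw [smul_smul, ← pow_succ', Nat.sub_add_comm hj']
  · simp

/-- Explicit inversion of the BDF2 difference recurrence: if `e 0 = e 1 = 0` and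
`(3/2)·e n − 2·e (n−1) + (1/2)·e (n−2) = f n` for all `n ≥ 2`, then
`e n = ∑_{j=2}^{n} (1 − (1/3)^{n−j+1}) · f j`. -/
theorem bdf2_recurrence_inversion {V : Type*} [AddCommGroup V] [Module ℝ V]
    (e f : ℕ → V) (h0 : e 0 = 0) (h1 : e 1 = 0)
    (hrec : ∀ n : ℕ, 2 ≤ n →
      (3 / 2 : ℝ) • e n - (2 : ℝ) • e (n - 1) + (1 / 2 : ℝ) • e (n - 2) = f n) :
    ∀ n : ℕ, e n = ∑ j ∈ Finset.Icc 2 n, (1 - (1 / 3 : ℝ) ^ (n - j + 1)) • f j := by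
  have hsplit (n : ℕ) : ∑ j ∈ Finset.Icc 2 n, (1 - (1 / 3 : ℝ) ^ (n - j + 1)) • f j =
      ∑ j ∈ Finset.Icc 2 n, f j - ∑ j ∈ Finset.Icc 2 n, (1 / 3 : ℝ) ^ (n - j + 1) • f j := by
    simp only [sub_smul, one_smul, Finset.sum_sub_distrib]
  intro n
  rw [hsplit]
  induction n using Nat.twoStepInduction with
  | zero => simp [h0]
  | one => simp [h1]
  | more n ih ih' =>
    have hstep : e (n + 2) =
        (4 / 3 : ℝ) • e (n + 1) - (1 / 3 : ℝ) • e n + (2 / 3 : ℝ) • f (n + 2) := by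
      rw [← hrec (n + 2) (by omega), show n + 2 - 1 = n + 1 by omega, Nat.add_sub_cancel]
      module
    have hsum : ∑ j ∈ Finset.Icc 2 (n + 2), f j =
        ∑ j ∈ Finset.Icc 2 (n + 1), f j + f (n + 2) :=
      Finset.sum_Icc_succ_top (by omega) f
    rw [hstep, hsum, sum_Icc_two_pow_smul_succ (1 / 3 : ℝ) f (n + 1) (by omega)]
    rcases Nat.eq_zero_or_pos n with rfl | hn
    · simp only [h0, h1, zero_add, Finset.Icc_eq_empty_of_lt one_lt_two, Finset.sum_empty]
      module
    · rw [ih, ih', sum_Icc_two_pow_smul_succ (1 / 3 : ℝ) f n hn,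
        Finset.sum_Icc_succ_top (by omega) f]
      module
end

section
/- Let H be a real inner product space, let τ ∈ ℝ, and let a, b, v ∈ H satisfy ⟨v, 2a − b⟩ = 0. Set c := (4/3)·a − (1/3)·b + (2/3)·τ·v. Then ‖c‖² = (4/3)‖a‖² − (1/3)‖b‖² + ‖c − 2a + b‖². -/
open scoped RealInnerProductSpace

/-- One BDF2 update step: if `⟪v, 2a − b⟫ = 0` and `c = (4/3)a − (1/3)b + (2/3)τ v`, then
`‖c‖² = (4/3)‖a‖² − (1/3)‖b‖² + ‖c − 2a + b‖²`. -/
theorem bdf2_nodal_length_identity {H : Type*} [NormedAddCommGroup H]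
    [InnerProductSpace ℝ H] (τ : ℝ) (a b v c : H)
    (horth : ⟪v, (2 : ℝ) • a - b⟫ = 0)
    (hc : c = (4 / 3 : ℝ) • a - (1 / 3 : ℝ) • b + ((2 / 3 : ℝ) * τ) • v) :
    ‖c‖ ^ 2 = (4 / 3 : ℝ) * ‖a‖ ^ 2 - (1 / 3 : ℝ) * ‖b‖ ^ 2
      + ‖c - (2 : ℝ) • a + b‖ ^ 2 := by
  subst hc
  simp only [← real_inner_self_eq_norm_sq, inner_add_left, inner_add_right, inner_sub_left,
    inner_sub_right, real_inner_smul_left, real_inner_smul_right] at horth ⊢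
  rw [real_inner_comm a b, real_inner_comm v a, real_inner_comm v b]
  linear_combination (4 / 3 : ℝ) * τ * horth
end

section
/- Let H be a real inner product space, let τ ∈ ℝ, and let a, b, v ∈ H satisfy ⟨v, 2a − b⟩ = 0 and ‖b‖ ≤ ‖a‖. Set c := (4/3)·a − (1/3)·b + (2/3)·τ·v. Then ‖c‖ ≥ ‖a‖. -/
open scoped RealInnerProductSpace

/-- Nodewise one-step norm growth of the projection-free BDF2 tangent-plane scheme:
if `⟪v, 2a − b⟫ = 0`, `‖b‖ ≤ ‖a‖`, and `c = (4/3)a − (1/3)b + (2/3)τ v`, then `‖c‖ ≥ ‖a‖`. -/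
theorem bdf2_nodal_length_growth {H : Type*} [NormedAddCommGroup H]
    [InnerProductSpace ℝ H] (τ : ℝ) (a b v c : H)
    (horth : ⟪v, (2 : ℝ) • a - b⟫ = 0) (hba : ‖b‖ ≤ ‖a‖)
    (hc : c = (4 / 3 : ℝ) • a - (1 / 3 : ℝ) • b + ((2 / 3 : ℝ) * τ) • v) :
    ‖a‖ ≤ ‖c‖ := by
  have inner_predictor : ⟪c, (2 : ℝ) • a - b⟫ = (8 * ‖a‖ ^ 2 - 6 * ⟪a, b⟫ + ‖b‖ ^ 2) / 3 := by
    rw [hc, inner_add_left, real_inner_smul_left v, horth]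
    simp only [inner_sub_left, inner_sub_right, real_inner_smul_left, real_inner_smul_right,
      real_inner_self_eq_norm_sq, real_inner_comm a b]
    ring
  have norm_predictor : ‖(2 : ℝ) • a - b‖ ^ 2 = 4 * ‖a‖ ^ 2 - 4 * ⟪a, b⟫ + ‖b‖ ^ 2 := by
    rw [norm_sub_sq_real, norm_smul, real_inner_smul_left, Real.norm_ofNat]
    ring
  have cauchy_schwarz := real_inner_le_norm c ((2 : ℝ) • a - b)
  have hsq : ‖b‖ ^ 2 ≤ ‖a‖ ^ 2 := by gcongr
  rcases (norm_nonneg ((2 : ℝ) • a - b)).eq_or_lt with hp | hp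
  · have hb : (2 : ℝ) • a = b := sub_eq_zero.mp (norm_eq_zero.mp hp.symm)
    rw [← hb, norm_smul, Real.norm_ofNat] at hba
    linarith [norm_nonneg a, norm_nonneg c]
  · refine le_of_mul_le_mul_right ?_ hp
    linarith [two_mul_le_add_sq ‖a‖ ‖(2 : ℝ) • a - b‖]
end

section
/- Let H be a real inner product space, let c > 0, and let a, b ∈ H with ‖a‖ ≥ c and ‖b‖ ≥ c. For a nonzero vector u define the tangential projection P(u)w := w − (⟨u,w⟩/‖u‖²)·u. Then for every v ∈ H it holds that ‖P(a)v − P(b)v‖ ≤ (4/c)·‖v‖·‖a − b‖. -/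
open scoped RealInnerProductSpace

/-- The normalization map `u ↦ ‖u‖⁻¹ • u` is Lipschitz away from the origin. -/
theorem norm_inv_norm_smul_sub_le {E : Type*} [NormedAddCommGroup E] [NormedSpace ℝ E]
    {a b : E} (ha : a ≠ 0) (hb : b ≠ 0) :
    ‖‖a‖⁻¹ • a - ‖b‖⁻¹ • b‖ ≤ 2 / ‖a‖ * ‖a - b‖ := by
  have ha' : ‖a‖ ≠ 0 := norm_ne_zero_iff.2 ha
  have hb' : ‖b‖ ≠ 0 := norm_ne_zero_iff.2 hb
  have key : ‖a‖⁻¹ • a - ‖b‖⁻¹ • b =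
      ‖a‖⁻¹ • ((a - b) + ((‖b‖ - ‖a‖) * ‖b‖⁻¹) • b) := by
    match_scalars <;> field_simp
    ring
  have hdiff : |‖b‖ - ‖a‖| ≤ ‖a - b‖ := by
    rw [norm_sub_rev a b]
    exact abs_norm_sub_norm_le b a
  have hsmul : ‖((‖b‖ - ‖a‖) * ‖b‖⁻¹) • b‖ = |‖b‖ - ‖a‖| := by
    rw [norm_smul, norm_mul, norm_inv, norm_norm, Real.norm_eq_abs,
      inv_mul_cancel_right₀ hb']
  calc ‖‖a‖⁻¹ • a - ‖b‖⁻¹ • b‖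
      = ‖a‖⁻¹ * ‖(a - b) + ((‖b‖ - ‖a‖) * ‖b‖⁻¹) • b‖ := by
        rw [key, norm_smul, norm_inv, norm_norm]
    _ ≤ ‖a‖⁻¹ * (‖a - b‖ + ‖a - b‖) := by
        gcongr
        exact (norm_add_le _ _).trans (by rw [hsmul]; gcongr)
    _ = 2 / ‖a‖ * ‖a - b‖ := by ring

/-- The rank-one maps `v ↦ ⟪x, v⟫ • x` depend Lipschitz continuously on `x` in the unit ball. -/
theorem norm_inner_smul_sub_inner_smul_le {E : Type*} [NormedAddCommGroup E]
    [InnerProductSpace ℝ E] {x y : E} (hx : ‖x‖ ≤ 1) (hy : ‖y‖ ≤ 1) (v : E) :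
    ‖⟪x, v⟫ • x - ⟪y, v⟫ • y‖ ≤ 2 * ‖v‖ * ‖x - y‖ := by
  have key : ⟪x, v⟫ • x - ⟪y, v⟫ • y = ⟪x - y, v⟫ • x + ⟪y, v⟫ • (x - y) := by
    rw [inner_sub_left]
    module
  calc ‖⟪x, v⟫ • x - ⟪y, v⟫ • y‖
      ≤ ‖⟪x - y, v⟫‖ * ‖x‖ + ‖⟪y, v⟫‖ * ‖x - y‖ := by
        rw [key, ← norm_smul, ← norm_smul]
        exact norm_add_le _ _
    _ ≤ ‖x - y‖ * ‖v‖ * 1 + 1 * ‖v‖ * ‖x - y‖ := by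
        gcongr
        · exact norm_inner_le_norm _ _
        · exact (norm_inner_le_norm _ _).trans (by gcongr)
    _ = 2 * ‖v‖ * ‖x - y‖ := by ring

/-- Lipschitz continuity of the tangential projection
`P(u)w = w − (⟪u,w⟫/‖u‖²) u` in its base vector: if `‖a‖, ‖b‖ ≥ c > 0`, then
`‖P(a)v − P(b)v‖ ≤ (4/c) ‖v‖ ‖a − b‖`. -/
theorem tangential_projection_lipschitz {H : Type*} [NormedAddCommGroup H]
    [InnerProductSpace ℝ H] (c : ℝ) (hc : 0 < c) (a b : H)
    (ha : c ≤ ‖a‖) (hb : c ≤ ‖b‖) (v : H) :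
    ‖(v - (⟪a, v⟫ / ‖a‖ ^ 2) • a) - (v - (⟪b, v⟫ / ‖b‖ ^ 2) • b)‖ ≤
      (4 / c) * ‖v‖ * ‖a - b‖ := by
  have ha0 : a ≠ 0 := norm_pos_iff.1 (hc.trans_le ha)
  have hb0 : b ≠ 0 := norm_pos_iff.1 (hc.trans_le hb)
  have normalize (u : H) : (⟪u, v⟫ / ‖u‖ ^ 2) • u = ⟪‖u‖⁻¹ • u, v⟫ • (‖u‖⁻¹ • u) := by
    rw [real_inner_smul_left, smul_smul]
    congr 1
    ring
  have norm_normalize {u : H} (hu : u ≠ 0) : ‖‖u‖⁻¹ • u‖ ≤ 1 := by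
    rw [norm_smul, norm_inv, norm_norm, inv_mul_cancel₀ (norm_ne_zero_iff.2 hu)]
  rw [sub_sub_sub_cancel_left, norm_sub_rev, normalize a, normalize b]
  calc _ ≤ 2 * ‖v‖ * ‖‖a‖⁻¹ • a - ‖b‖⁻¹ • b‖ :=
        norm_inner_smul_sub_inner_smul_le (norm_normalize ha0) (norm_normalize hb0) v
    _ ≤ 2 * ‖v‖ * (2 / c * ‖a - b‖) := by
        gcongr
        exact (norm_inv_norm_smul_sub_le ha0 hb0).trans (by gcongr)
    _ = 4 / c * ‖v‖ * ‖a - b‖ := by ring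
end

section
/- For every c > 0 there exists a constant C > 0, depending only on c, with the following property. Let E be a real normed vector space, H a real inner product space, and u : E → H twice continuously differentiable on a neighborhood of x ∈ E with ‖u(x)‖ ≥ c. Then the map N∘u : y ↦ ‖u(y)‖⁻¹·u(y) is twice differentiable at x and ‖D²(N∘u)(x)‖ ≤ C·( ‖D²u(x)‖ + ‖Du(x)‖² ), where D²(N∘u)(x) and D²u(x) denote the second Fréchet derivatives (as continuous bilinear maps) and ‖Du(x)‖ the operator norm of the first derivative. -/
universe u v

open Set
open scoped Nat ContDiff

theorem ContDiffAt.exists_isOpen_contDiffOn {𝕜 E F : Type*} [NontriviallyNormedField 𝕜]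
    [NormedAddCommGroup E] [NormedSpace 𝕜 E] [NormedAddCommGroup F] [NormedSpace 𝕜 F]
    {n : ℕ} {f : E → F} {x : E} (hf : ContDiffAt 𝕜 n f x) :
    ∃ s, IsOpen s ∧ x ∈ s ∧ ContDiffOn 𝕜 n f s := by
  obtain ⟨s, hs, hso, hxs⟩ := eventually_nhds_iff.1 (hf.eventually (by simp))
  exact ⟨s, hso, hxs, fun y hy => (hs y hy).contDiffWithinAt⟩

theorem ContDiffAt.norm_iteratedFDeriv_comp_le {𝕜 E F G : Type*} [NontriviallyNormedField 𝕜]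
    [NormedAddCommGroup E] [NormedSpace 𝕜 E] [NormedAddCommGroup F] [NormedSpace 𝕜 F]
    [NormedAddCommGroup G] [NormedSpace 𝕜 G] {g : F → G} {f : E → F} {n : ℕ} {x : E}
    (hg : ContDiffAt 𝕜 n g (f x)) (hf : ContDiffAt 𝕜 n f x) {C D : ℝ}
    (hC : ∀ i ≤ n, ‖iteratedFDeriv 𝕜 i g (f x)‖ ≤ C)
    (hD : ∀ i, 1 ≤ i → i ≤ n → ‖iteratedFDeriv 𝕜 i f x‖ ≤ D ^ i) :
    ‖iteratedFDeriv 𝕜 n (g ∘ f) x‖ ≤ n ! * C * D ^ n := by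
  obtain ⟨t, hto, hxt, hgt⟩ := hg.exists_isOpen_contDiffOn
  obtain ⟨s, hso, hxs, hfs⟩ := hf.exists_isOpen_contDiffOn
  have hro : IsOpen (s ∩ f ⁻¹' t) := hfs.continuousOn.isOpen_inter_preimage hso hto
  have hxr : x ∈ s ∩ f ⁻¹' t := ⟨hxs, hxt⟩
  rw [← iteratedFDerivWithin_of_isOpen n hro hxr]
  refine norm_iteratedFDerivWithin_comp_le hgt (hfs.mono inter_subset_left) le_rfl
    hto.uniqueDiffOn hro.uniqueDiffOn (fun y hy => hy.2) hxr (fun i hi => ?_) fun i h1 hi => ?_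
  · rw [iteratedFDerivWithin_of_isOpen i hto hxt]
    exact hC i hi
  · rw [iteratedFDerivWithin_of_isOpen i hro hxr]
    exact hD i h1 hi

theorem ContDiffAt.norm_iteratedFDeriv_smul_le {𝕜 E F : Type*} [NontriviallyNormedField 𝕜]
    [NormedAddCommGroup E] [NormedSpace 𝕜 E] [NormedAddCommGroup F] [NormedSpace 𝕜 F]
    {f : E → 𝕜} {g : E → F} {n : ℕ} {x : E}
    (hf : ContDiffAt 𝕜 n f x) (hg : ContDiffAt 𝕜 n g x) :
    ‖iteratedFDeriv 𝕜 n (fun y => f y • g y) x‖ ≤ ∑ i ∈ Finset.range (n + 1),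
      (n.choose i : ℝ) * ‖iteratedFDeriv 𝕜 i f x‖ * ‖iteratedFDeriv 𝕜 (n - i) g x‖ := by
  obtain ⟨s, hso, hxs, hfs⟩ := hf.exists_isOpen_contDiffOn
  obtain ⟨t, hto, hxt, hgt⟩ := hg.exists_isOpen_contDiffOn
  have hro : IsOpen (s ∩ t) := hso.inter hto
  have hxr : x ∈ s ∩ t := ⟨hxs, hxt⟩
  have h := norm_iteratedFDerivWithin_smul_le (hfs.mono inter_subset_left)
    (hgt.mono inter_subset_right) hro.uniqueDiffOn hxr le_rfl
  simpa only [iteratedFDerivWithin_of_isOpen _ hro hxr] using h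

theorem norm_iteratedFDeriv_id_le_one {𝕜 E : Type*} [NontriviallyNormedField 𝕜]
    [NormedAddCommGroup E] [NormedSpace 𝕜 E] {x : E} (hx : ‖x‖ ≤ 1) (n : ℕ) :
    ‖iteratedFDeriv 𝕜 n (fun y : E => y) x‖ ≤ 1 := by
  match n with
  | 0 => simpa using hx
  | 1 =>
    rw [norm_iteratedFDeriv_one, fderiv_fun_id]
    exact ContinuousLinearMap.norm_id_le
  | n + 2 =>
    rw [← norm_iteratedFDeriv_fderiv]
    have : fderiv 𝕜 (fun y : E => y) = fun _ => ContinuousLinearMap.id 𝕜 E := by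
      ext1 y
      exact fderiv_fun_id
    rw [this, iteratedFDeriv_succ_const]
    simp

theorem norm_iteratedFDeriv_norm_sq_le {H : Type*} [NormedAddCommGroup H] [InnerProductSpace ℝ H]
    {w : H} (hw : ‖w‖ ≤ 1) (n : ℕ) :
    ‖iteratedFDeriv ℝ n (fun y : H => ‖y‖ ^ 2) w‖ ≤ 2 ^ n := by
  have hsq : (fun y : H => ‖y‖ ^ 2) = fun y : H => innerSL ℝ y y := by
    ext y
    simp
  rw [hsq]
  calc _ ≤ ∑ i ∈ Finset.range (n + 1), (n.choose i : ℝ) *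
        ‖iteratedFDeriv ℝ i (fun y : H => y) w‖ * ‖iteratedFDeriv ℝ (n - i) (fun y : H => y) w‖ :=
        (innerSL ℝ).norm_iteratedFDeriv_le_of_bilinear_of_le_one contDiff_id contDiff_id w le_rfl
          (norm_innerSL_le ℝ)
    _ ≤ ∑ i ∈ Finset.range (n + 1), (n.choose i : ℝ) := by
        gcongr with i
        rw [mul_assoc]
        exact mul_le_of_le_one_right (by positivity) (mul_le_one₀
          (norm_iteratedFDeriv_id_le_one hw i) (norm_nonneg _)
          (norm_iteratedFDeriv_id_le_one hw (n - i)))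
    _ = 2 ^ n := by exact_mod_cast Nat.sum_range_choose n

theorem contDiffAt_inv_norm_smul {H : Type*} [NormedAddCommGroup H] [InnerProductSpace ℝ H]
    {n : ℕ∞ω} {w : H} (hw : w ≠ 0) : ContDiffAt ℝ n (fun y : H => ‖y‖⁻¹ • y) w :=
  ((contDiffAt_norm ℝ hw).inv (norm_ne_zero_iff.2 hw)).smul contDiffAt_id

/-- The derivatives of the normalization map at unit vectors are bounded independently of the
inner product space. -/
theorem exists_norm_iteratedFDeriv_inv_norm_smul_le (n : ℕ) :
    ∃ C : ℝ, ∀ (H : Type v) [NormedAddCommGroup H] [InnerProductSpace ℝ H] (w : H), ‖w‖ = 1 →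
      ‖iteratedFDeriv ℝ n (fun y : H => ‖y‖⁻¹ • y) w‖ ≤ C := by
  set ψ : ℝ → ℝ := fun t => (√t)⁻¹
  have hψ (k : ℕ) : ContDiffAt ℝ k ψ 1 :=
    (Real.contDiffAt_sqrt one_ne_zero).inv (by simp)
  refine ⟨∑ i ∈ Finset.range (n + 1), (n.choose i : ℝ) *
    (i ! * (∑ j ∈ Finset.range (i + 1), ‖iteratedFDeriv ℝ j ψ 1‖) * 2 ^ i), ?_⟩
  intro H _ _ w hw
  have hψw (k : ℕ) : ContDiffAt ℝ k ψ (‖w‖ ^ 2) := by simpa [hw] using hψ k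
  have hsq (k : ℕ) : ContDiffAt ℝ k (fun y : H => ‖y‖ ^ 2) w := (contDiff_norm_sq ℝ).contDiffAt
  have hN : (fun y : H => ‖y‖⁻¹ • y) = fun y => (ψ ∘ fun z : H => ‖z‖ ^ 2) y • y := by
    ext y
    simp [ψ]
  rw [hN]
  refine (((hψw n).comp w (hsq n)).norm_iteratedFDeriv_smul_le contDiffAt_id).trans ?_
  refine Finset.sum_le_sum fun i _ => ?_
  rw [mul_assoc]
  refine mul_le_mul_of_nonneg_left ?_ (by positivity)
  refine (mul_le_of_le_one_right (norm_nonneg _)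
    (norm_iteratedFDeriv_id_le_one hw.le (n - i))).trans ?_
  refine ContDiffAt.norm_iteratedFDeriv_comp_le (f := fun y : H => ‖y‖ ^ 2) (hψw i) (hsq i)
    (fun j hj => ?_) fun j _ _ => norm_iteratedFDeriv_norm_sq_le hw.le j
  simp only [hw, one_pow]
  exact Finset.single_le_sum (f := fun j => ‖iteratedFDeriv ℝ j ψ 1‖)
    (fun _ _ => norm_nonneg _) (Finset.mem_range.2 (by lia))

theorem norm_iteratedFDeriv_two_eq_norm_fderiv_fderiv {𝕜 E F : Type*} [NontriviallyNormedField 𝕜]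
    [NormedAddCommGroup E] [NormedSpace 𝕜 E] [NormedAddCommGroup F] [NormedSpace 𝕜 F]
    (f : E → F) (x : E) : ‖iteratedFDeriv 𝕜 2 f x‖ = ‖fderiv 𝕜 (fderiv 𝕜 f) x‖ := by
  rw [← norm_iteratedFDeriv_fderiv, norm_iteratedFDeriv_one]

/-- Second-derivative bound for the normalized composition: for every `c > 0` there is a
constant `C > 0`, depending only on `c`, such that whenever `u : E → H` is twice
continuously differentiable near `x` and `‖u x‖ ≥ c`, the map `y ↦ ‖u y‖⁻¹ • u y` is
twice differentiable at `x` with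
`‖D²(N∘u)(x)‖ ≤ C (‖D²u(x)‖ + ‖Du(x)‖²)`. -/
theorem normalization_second_deriv_bound (c : ℝ) (hc : 0 < c) :
    ∃ C : ℝ, 0 < C ∧
      ∀ (E : Type u) (H : Type v) [NormedAddCommGroup E] [NormedSpace ℝ E]
        [NormedAddCommGroup H] [InnerProductSpace ℝ H]
        (u : E → H) (x : E),
        ContDiffAt ℝ 2 u x → c ≤ ‖u x‖ →
          DifferentiableAt ℝ (fderiv ℝ fun y : E => ‖u y‖⁻¹ • u y) x ∧
          ‖fderiv ℝ (fderiv ℝ fun y : E => ‖u y‖⁻¹ • u y) x‖ ≤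
            C * (‖fderiv ℝ (fderiv ℝ u) x‖ + ‖fderiv ℝ u x‖ ^ 2) := by
  choose K hK using exists_norm_iteratedFDeriv_inv_norm_smul_le.{v}
  set M : ℝ := 1 + ∑ i ∈ Finset.range 3, |K i|
  have hM0 : 0 < M := by positivity
  have hKM (i : ℕ) (hi : i ≤ 2) : K i ≤ M := by
    have := Finset.single_le_sum (f := fun i => |K i|) (fun _ _ => abs_nonneg _)
      (Finset.mem_range.2 (by lia : i < 3))
    linarith [le_abs_self (K i)]
  refine ⟨2 * M * (c⁻¹ + (c⁻¹) ^ 2), by positivity, ?_⟩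
  intro E H _ _ _ _ u x hu hux
  have hr : 0 < ‖u x‖ := hc.trans_le hux
  have hux0 : u x ≠ 0 := norm_pos_iff.1 hr
  have hNu : ContDiffAt ℝ 2 (fun y => ‖u y‖⁻¹ • u y) x :=
    (contDiffAt_inv_norm_smul hux0).comp x hu
  refine ⟨(hNu.fderiv_right (m := 1) (by norm_num)).differentiableAt one_ne_zero, ?_⟩
  -- Replacing `u` by `‖u x‖⁻¹ • u` leaves `N ∘ u` unchanged and makes its argument a unit
  -- vector at `x`.
  set a : ℝ := ‖u x‖⁻¹ with ha
  have ha0 : 0 < a := inv_pos.2 hr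
  have hac : a ≤ c⁻¹ := inv_anti₀ hc hux
  have hscale : (fun y => ‖u y‖⁻¹ • u y) = (fun w : H => ‖w‖⁻¹ • w) ∘ fun y => a • u y := by
    ext y
    simp only [Function.comp_apply, norm_smul, Real.norm_of_nonneg ha0.le, smul_smul, mul_inv]
    congr 1
    field_simp
  have hv1 : ‖a • u x‖ = 1 := by
    rw [norm_smul, Real.norm_of_nonneg ha0.le, ha, inv_mul_cancel₀ hr.ne']
  have hv (i : ℕ) (hi : i ≤ 2) :
      ‖iteratedFDeriv ℝ i (fun y => a • u y) x‖ = a * ‖iteratedFDeriv ℝ i u x‖ := by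
    rw [iteratedFDeriv_const_smul_apply' (hu.of_le (by exact_mod_cast hi)), norm_smul,
      Real.norm_of_nonneg ha0.le]
  set P := ‖fderiv ℝ (fderiv ℝ u) x‖
  set Q := ‖fderiv ℝ u x‖
  have hP : 0 ≤ P := norm_nonneg (fderiv ℝ (fderiv ℝ u) x)
  have hQ : 0 ≤ Q := norm_nonneg _
  have hDnn : 0 ≤ a * P + (a * Q) ^ 2 := by positivity
  have hbound := ContDiffAt.norm_iteratedFDeriv_comp_le (n := 2)
    (contDiffAt_inv_norm_smul (norm_pos_iff.1 (hv1.symm ▸ one_pos))) (hu.const_smul a) (C := M)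
    (D := √(a * P + (a * Q) ^ 2))
    (fun i hi => (hK i H _ hv1).trans (hKM i hi))
    (by
      intro i h1 hi
      interval_cases i
      · rw [hv 1 (by norm_num), norm_iteratedFDeriv_one, pow_one]
        exact Real.le_sqrt_of_sq_le (by nlinarith [mul_nonneg ha0.le hP])
      · rw [hv 2 le_rfl, norm_iteratedFDeriv_two_eq_norm_fderiv_fderiv, Real.sq_sqrt hDnn]
        exact le_add_of_nonneg_right (sq_nonneg _))
  rw [← norm_iteratedFDeriv_two_eq_norm_fderiv_fderiv, hscale]
  refine hbound.trans ?_
  rw [Real.sq_sqrt hDnn, mul_assoc (2 * M)]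
  have h : a * P + (a * Q) ^ 2 ≤ (c⁻¹ + c⁻¹ ^ 2) * (P + Q ^ 2) :=
    calc a * P + (a * Q) ^ 2 = a * P + a ^ 2 * Q ^ 2 := by ring
      _ ≤ c⁻¹ * P + c⁻¹ ^ 2 * Q ^ 2 := by gcongr
      _ ≤ (c⁻¹ + c⁻¹ ^ 2) * (P + Q ^ 2) := by
        have : 0 ≤ c⁻¹ * Q ^ 2 + c⁻¹ ^ 2 * P := by positivity
        linarith
  simpa using mul_le_mul_of_nonneg_left h (by positivity : 0 ≤ 2 * M)
end

section
/- For every c > 0 there exists a constant C > 0, depending only on c, with the following property. Let E be a real normed vector space, H a real inner product space, and let u, ũ : E → H be Fréchet differentiable at x ∈ E with c ≤ ‖u(x)‖ ≤ 1/c and c ≤ ‖ũ(x)‖ ≤ 1/c. Then, with N(w) := ‖w‖⁻¹·w, both N∘u and N∘ũ are differentiable at x and ‖D(N∘u)(x) − D(N∘ũ)(x)‖ ≤ C·( ‖Du(x) − Dũ(x)‖ + (‖Du(x)‖ + ‖Dũ(x)‖)·‖u(x) − ũ(x)‖ ), where ‖·‖ denotes the operator norm of the Fréchet derivatives. -/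
universe u v

open scoped RealInnerProductSpace

section Normalization

variable {E : Type*} {H : Type*} [NormedAddCommGroup E] [NormedSpace ℝ E]
  [NormedAddCommGroup H] [InnerProductSpace ℝ H]

theorem HasFDerivAt.norm_inv_smul_self {u : E → H} {u' : E →L[ℝ] H} {x : E}
    (hu : HasFDerivAt u u' x) (h0 : u x ≠ 0) :
    HasFDerivAt (fun y => ‖u y‖⁻¹ • u y)
      (‖u x‖⁻¹ • (u' - ((innerSL ℝ (‖u x‖⁻¹ • u x)).comp u').smulRight (‖u x‖⁻¹ • u x))) x := by
  have hn : ‖u x‖ ≠ 0 := norm_ne_zero_iff.2 h0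
  have hnorm : HasFDerivAt (fun y => ‖u y‖) (‖u x‖⁻¹ • (innerSL ℝ (u x)).comp u') x := by
    have h := hu.norm_sq.sqrt (pow_ne_zero 2 hn)
    simp only [Real.sqrt_sq (norm_nonneg _)] at h
    refine h.congr_fderiv ?_
    ext e
    simp
    field_simp
  refine (((hasDerivAt_inv hn).comp_hasFDerivAt x hnorm).smul hu).congr_fderiv ?_
  ext e
  simp [smul_smul, sub_eq_add_neg]
  congr 1
  field_simp

theorem abs_norm_inv_sub_norm_inv_le {F : Type*} [SeminormedAddCommGroup F] {c : ℝ} (hc : 0 < c)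
    {a b : F} (ha : c ≤ ‖a‖)
    (hb : c ≤ ‖b‖) : |‖a‖⁻¹ - ‖b‖⁻¹| ≤ ‖a - b‖ / c ^ 2 := by
  have ha0 := hc.trans_le ha
  have hb0 := hc.trans_le hb
  rw [inv_sub_inv ha0.ne' hb0.ne', abs_div, abs_of_pos (mul_pos ha0 hb0), abs_sub_comm]
  exact div_le_div₀ (norm_nonneg _) (abs_norm_sub_norm_le a b) (by positivity)
    (by rw [sq]; gcongr)

theorem norm_norm_inv_smul_sub_le {c : ℝ} (hc : 0 < c) {a b : H} (ha : c ≤ ‖a‖)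
    (hb : c ≤ ‖b‖) : ‖‖a‖⁻¹ • a - ‖b‖⁻¹ • b‖ ≤ 2 / c * ‖a - b‖ := by
  have ha0 := hc.trans_le ha
  have hb0 := hc.trans_le hb
  have hinv : ‖a‖⁻¹ ≤ c⁻¹ := inv_anti₀ hc ha
  have hscalar : |‖a‖⁻¹ - ‖b‖⁻¹| * ‖b‖ ≤ c⁻¹ * ‖a - b‖ := by
    rw [inv_sub_inv ha0.ne' hb0.ne', abs_div, abs_of_pos (mul_pos ha0 hb0), abs_sub_comm]
    calc |‖a‖ - ‖b‖| / (‖a‖ * ‖b‖) * ‖b‖ = ‖a‖⁻¹ * |‖a‖ - ‖b‖| := by field_simp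
      _ ≤ c⁻¹ * ‖a - b‖ := by
        gcongr
        exact abs_norm_sub_norm_le a b
  calc ‖‖a‖⁻¹ • a - ‖b‖⁻¹ • b‖ = ‖‖a‖⁻¹ • (a - b) + (‖a‖⁻¹ - ‖b‖⁻¹) • b‖ := by
        congr 1; module
    _ ≤ ‖a‖⁻¹ * ‖a - b‖ + |‖a‖⁻¹ - ‖b‖⁻¹| * ‖b‖ := by
        refine (norm_add_le _ _).trans_eq ?_
        simp [norm_smul]
    _ ≤ c⁻¹ * ‖a - b‖ + c⁻¹ * ‖a - b‖ := by gcongr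
    _ = 2 / c * ‖a - b‖ := by ring

theorem norm_sub_inner_smul_le {m : H} (hm : ‖m‖ = 1) (h : H) : ‖h - ⟪m, h⟫ • m‖ ≤ 2 * ‖h‖ := by
  refine (norm_sub_le _ _).trans ?_
  have := abs_real_inner_le_norm m h
  rw [norm_smul, Real.norm_eq_abs, hm]
  rw [hm] at this
  linarith

theorem norm_inner_smul_sub_inner_smul_le_s14 {m n : H} (hm : ‖m‖ = 1) (hn : ‖n‖ = 1) (h : H) :
    ‖⟪m, h⟫ • m - ⟪n, h⟫ • n‖ ≤ 2 * ‖m - n‖ * ‖h‖ := by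
  calc ‖⟪m, h⟫ • m - ⟪n, h⟫ • n‖ = ‖⟪m, h⟫ • (m - n) + ⟪m - n, h⟫ • n‖ := by
        rw [inner_sub_left]; congr 1; module
    _ ≤ |⟪m, h⟫| * ‖m - n‖ + |⟪m - n, h⟫| * ‖n‖ := by
        refine (norm_add_le _ _).trans_eq ?_
        simp [norm_smul]
    _ ≤ (‖m‖ * ‖h‖) * ‖m - n‖ + (‖m - n‖ * ‖h‖) * ‖n‖ := by
        gcongr <;> exact abs_real_inner_le_norm _ _
    _ = 2 * ‖m - n‖ * ‖h‖ := by rw [hm, hn]; ring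

theorem norm_smul_sub_inner_smul_sub_le {c : ℝ} (hc : 0 < c) {a b : H} (ha : c ≤ ‖a‖)
    (hb : c ≤ ‖b‖) (h k : H) :
    ‖‖a‖⁻¹ • (h - ⟪‖a‖⁻¹ • a, h⟫ • (‖a‖⁻¹ • a)) -
        ‖b‖⁻¹ • (k - ⟪‖b‖⁻¹ • b, k⟫ • (‖b‖⁻¹ • b))‖ ≤
      2 / c * ‖h - k‖ + 6 / c ^ 2 * ‖a - b‖ * ‖k‖ := by
  have hm : ‖‖a‖⁻¹ • a‖ = 1 := norm_smul_inv_norm (norm_pos_iff.1 (hc.trans_le ha))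
  have hn : ‖‖b‖⁻¹ • b‖ = 1 := norm_smul_inv_norm (norm_pos_iff.1 (hc.trans_le hb))
  have hmn := norm_norm_inv_smul_sub_le hc ha hb
  have hp : ‖a‖⁻¹ ≤ c⁻¹ := inv_anti₀ hc ha
  have hq : ‖b‖⁻¹ ≤ c⁻¹ := inv_anti₀ hc hb
  have hpq := abs_norm_inv_sub_norm_inv_le hc ha hb
  have hq0 : 0 ≤ ‖b‖⁻¹ := by positivity
  have hp0 : 0 ≤ ‖a‖⁻¹ := by positivity
  generalize ‖a‖⁻¹ • a = m at *
  generalize ‖b‖⁻¹ • b = n at *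
  generalize ‖a‖⁻¹ = p at *
  generalize ‖b‖⁻¹ = q at *
  calc ‖p • (h - ⟪m, h⟫ • m) - q • (k - ⟪n, k⟫ • n)‖
      = ‖p • ((h - k) - ⟪m, h - k⟫ • m) + (p - q) • (k - ⟪m, k⟫ • m) -
          q • (⟪m, k⟫ • m - ⟪n, k⟫ • n)‖ := by
        rw [inner_sub_right]; congr 1; module
    _ ≤ p * ‖(h - k) - ⟪m, h - k⟫ • m‖ + |p - q| * ‖k - ⟪m, k⟫ • m‖ +
          q * ‖⟪m, k⟫ • m - ⟪n, k⟫ • n‖ := by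
        refine (norm_sub_le _ _).trans ((add_le_add_left (norm_add_le _ _) _).trans_eq ?_)
        simp [norm_smul, abs_of_nonneg hp0, abs_of_nonneg hq0]
    _ ≤ c⁻¹ * (2 * ‖h - k‖) + ‖a - b‖ / c ^ 2 * (2 * ‖k‖) +
          c⁻¹ * (2 * (2 / c * ‖a - b‖) * ‖k‖) := by
        gcongr
        · exact norm_sub_inner_smul_le hm _
        · exact norm_sub_inner_smul_le hm _
        · refine (norm_inner_smul_sub_inner_smul_le_s14 hm hn k).trans ?_
          gcongr
    _ = 2 / c * ‖h - k‖ + 6 / c ^ 2 * ‖a - b‖ * ‖k‖ := by field_simp; ring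

end Normalization

/-- Lipschitz estimate for the derivative of the normalization map: for every `c > 0`
there is a constant `C > 0`, depending only on `c`, such that whenever `u, ũ : E → H`
are Fréchet differentiable at `x` with `c ≤ ‖u x‖, ‖ũ x‖ ≤ 1/c`, the maps
`N∘u, N∘ũ` (with `N(w) = ‖w‖⁻¹ w`) are differentiable at `x` and
`‖D(N∘u)(x) − D(N∘ũ)(x)‖ ≤ C (‖Du(x) − Dũ(x)‖ + (‖Du(x)‖ + ‖Dũ(x)‖) ‖u x − ũ x‖)`. -/
theorem normalization_deriv_lipschitz (c : ℝ) (hc : 0 < c) :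
    ∃ C : ℝ, 0 < C ∧
      ∀ (E : Type u) (H : Type v) [NormedAddCommGroup E] [NormedSpace ℝ E]
        [NormedAddCommGroup H] [InnerProductSpace ℝ H]
        (u v : E → H) (x : E) (u' v' : E →L[ℝ] H),
        HasFDerivAt u u' x → HasFDerivAt v v' x →
        c ≤ ‖u x‖ → ‖u x‖ ≤ 1 / c → c ≤ ‖v x‖ → ‖v x‖ ≤ 1 / c →
          DifferentiableAt ℝ (fun y : E => ‖u y‖⁻¹ • u y) x ∧
          DifferentiableAt ℝ (fun y : E => ‖v y‖⁻¹ • v y) x ∧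
          ‖fderiv ℝ (fun y : E => ‖u y‖⁻¹ • u y) x
              - fderiv ℝ (fun y : E => ‖v y‖⁻¹ • v y) x‖ ≤
            C * (‖u' - v'‖ + (‖u'‖ + ‖v'‖) * ‖u x - v x‖) := by
  refine ⟨2 / c + 6 / c ^ 2, by positivity, ?_⟩
  intro E H _ _ _ _ u v x u' v' hu hv huc _ hvc _
  have hNu := hu.norm_inv_smul_self (norm_pos_iff.1 (hc.trans_le huc))
  have hNv := hv.norm_inv_smul_self (norm_pos_iff.1 (hc.trans_le hvc))
  refine ⟨hNu.differentiableAt, hNv.differentiableAt, ?_⟩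
  rw [hNu.fderiv, hNv.fderiv]
  have hle : 2 / c * ‖u' - v'‖ + 6 / c ^ 2 * ‖u x - v x‖ * ‖v'‖ ≤
      (2 / c + 6 / c ^ 2) * (‖u' - v'‖ + (‖u'‖ + ‖v'‖) * ‖u x - v x‖) := by
    rw [← sub_nonneg]
    ring_nf
    positivity
  refine (ContinuousLinearMap.opNorm_le_bound _ (by positivity) fun e => ?_).trans hle
  calc _ ≤ 2 / c * ‖(u' - v') e‖ + 6 / c ^ 2 * ‖u x - v x‖ * ‖v' e‖ :=
        norm_smul_sub_inner_smul_sub_le hc huc hvc (u' e) (v' e)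
    _ ≤ 2 / c * (‖u' - v'‖ * ‖e‖) + 6 / c ^ 2 * ‖u x - v x‖ * (‖v'‖ * ‖e‖) := by
        gcongr <;> exact ContinuousLinearMap.le_opNorm _ _
    _ = (2 / c * ‖u' - v'‖ + 6 / c ^ 2 * ‖u x - v x‖ * ‖v'‖) * ‖e‖ := by ring
end
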